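/- Let k ≥ 1 be an integer and let P ⊂ ℝ^n be a full-dimensional smooth lattice polytope that is canonically positioned, such that F := P ∩ {x : x_1 = 0} is a facet of P and every edge of P has lattice length at least k. Then P' := P ∩ {x : x_1 ≥ 1} is a lattice polytope, and every edge of P' has lattice length at least k − 1. -/

import Mathlib

open Set

/-- The real point corresponding to an integer lattice point. -/
def toR {n : ℕ} (v : Fin n → ℤ) : Fin n → ℝ := fun i => (v i : ℝ)

/-- `P` is a lattice polytope: the convex hull of a finite set of integer points. -/
def IsLatticePolytope {n : ℕ} (P : Set (Fin n → ℝ)) : Prop :=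
  ∃ S : Finset (Fin n → ℤ), P = convexHull ℝ (toR '' (S : Set (Fin n → ℤ)))

/-- `P` is full-dimensional: its affine span is everything. -/
def IsFullDim {n : ℕ} (P : Set (Fin n → ℝ)) : Prop :=
  affineSpan ℝ P = ⊤

/-- A vertex of `P` is an extreme point of `P`. -/
def IsVertex {n : ℕ} (P : Set (Fin n → ℝ)) (v : Fin n → ℝ) : Prop :=
  v ∈ Set.extremePoints ℝ P

/-- The segment from `a` to `b` (distinct integer points) is an edge of `P`,
i.e. an exposed face of `P` which is a segment. -/
def IsEdge {n : ℕ} (P : Set (Fin n → ℝ)) (a b : Fin n → ℤ) : Prop :=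
  a ≠ b ∧ IsExposed ℝ P (segment ℝ (toR a) (toR b))

/-- The lattice length of an integer vector: the gcd of its entries. -/
def latticeLength {n : ℕ} (v : Fin n → ℤ) : ℕ :=
  Finset.univ.gcd fun i => (v i).natAbs

/-- The primitive integer vector in the direction of `v`. -/
def primVec {n : ℕ} (v : Fin n → ℤ) : Fin n → ℤ :=
  fun i => v i / (latticeLength v : ℤ)

/-- `P` is smooth at the integer vertex `v`: there are exactly `n` edges through `v`
and the primitive directions of these edges form a `ℤ`-basis of `ℤⁿ`. -/
def SmoothAtVertex {n : ℕ} (P : Set (Fin n → ℝ)) (v : Fin n → ℤ) : Prop :=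
  ∃ b : Fin n → (Fin n → ℤ),
    Function.Injective b ∧
    (∀ i, IsEdge P v (b i)) ∧
    (∀ c : Fin n → ℤ, IsEdge P v c →
      ∃ i, segment ℝ (toR v) (toR c) = segment ℝ (toR v) (toR (b i))) ∧
    IsUnit (Matrix.det (Matrix.of fun i => primVec (b i - v)))

/-- `P` is a full-dimensional smooth lattice polytope. -/
def IsSmoothPolytope {n : ℕ} (P : Set (Fin n → ℝ)) : Prop :=
  IsLatticePolytope P ∧ IsFullDim P ∧
    ∀ v : Fin n → ℤ, IsVertex P (toR v) → SmoothAtVertex P v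

/-- Every edge of `P` has lattice length at least `k`. -/
def EdgesAtLeast {n : ℕ} (P : Set (Fin n → ℝ)) (k : ℕ) : Prop :=
  ∀ a b : Fin n → ℤ, IsEdge P a b → k ≤ latticeLength (b - a)

/-- `P` is a Cayley polytope of order `k` with altitude in direction `eᵢ`:
`P ⊆ {x : 0 ≤ xᵢ ≤ k}` and every vertex of `P` has `i`-th coordinate `0` or `k`. -/
def IsCayley {n : ℕ} (P : Set (Fin n → ℝ)) (k : ℕ) (i : Fin n) : Prop :=
  (∀ x ∈ P, 0 ≤ x i ∧ x i ≤ (k : ℝ)) ∧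
  (∀ v : Fin n → ℝ, IsVertex P v → v i = 0 ∨ v i = (k : ℝ))

/-- `P` is canonically positioned: `0` is a vertex and for each `i` there is an
edge of `P` contained in the nonnegative `xᵢ`-coordinate axis. -/
def CanonicallyPositioned {n : ℕ} (P : Set (Fin n → ℝ)) : Prop :=
  IsVertex P 0 ∧
  ∀ i : Fin n, ∃ a b : Fin n → ℤ, IsEdge P a b ∧
    segment ℝ (toR a) (toR b) ⊆ {x | 0 ≤ x i ∧ ∀ j, j ≠ i → x j = 0}

/-- `F` is a facet of `P`: an exposed face of dimension `n - 1`. -/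
def IsFacet {n : ℕ} (P F : Set (Fin n → ℝ)) : Prop :=
  IsExposed ℝ P F ∧ Module.finrank ℝ (affineSpan ℝ F).direction = n - 1

/-- The lattice width of `Q`: the minimum over nonzero integer functionals `φ` of
`max_{x ∈ Q} ⟨φ, x⟩ - min_{x ∈ Q} ⟨φ, x⟩`. -/
noncomputable def latticeWidth {n : ℕ} (Q : Set (Fin n → ℝ)) : ℝ :=
  ⨅ φ : {φ : Fin n → ℤ // φ ≠ 0},
    (sSup ((fun x => ∑ i, (φ.1 i : ℝ) * x i) '' Q) -
      sInf ((fun x => ∑ i, (φ.1 i : ℝ) * x i) '' Q))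

section Convex

variable {E : Type*} [NormedAddCommGroup E] [NormedSpace ℝ E]

/-- An extreme point of the convex hull of a finite set can be strictly separated from the
remaining points of that set. -/
lemma exists_dual_lt_of_mem_extremePoints_convexHull {T : Set E} (hT : T.Finite) {p : E}
    (hp : p ∈ (convexHull ℝ T).extremePoints ℝ) :
    ∃ l : StrongDual ℝ E, ∀ t ∈ T, t ≠ p → l t < l p := by
  have hp' := ((convex_convexHull ℝ T).mem_extremePoints_iff_mem_sdiff_convexHull_sdiff.1 hp).2
  have hnot : p ∉ convexHull ℝ (T \ {p}) := fun h =>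
    hp' (convexHull_mono (sdiff_subset_sdiff_left (subset_convexHull ℝ T)) h)
  have hcl : IsClosed (convexHull ℝ (T \ {p})) := (hT.sdiff).isClosed_convexHull ℝ
  obtain ⟨f, u, hfu, huf⟩ :=
    geometric_hahn_banach_point_closed (convex_convexHull ℝ _) hcl hnot
  refine ⟨-f, fun t ht htp => ?_⟩
  have := huf t (subset_convexHull ℝ _ ⟨ht, htp⟩)
  simp only [neg_apply]
  linarith

/-- The part of a convex hull lying on a supporting hyperplane is the convex hull of the
generators lying on it. -/
lemma mem_convexHull_of_eq_of_le {T : Set E} {l : E →ₗ[ℝ] ℝ} {r : ℝ} (hl : ∀ t ∈ T, l t ≤ r)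
    {x : E} (hx : x ∈ convexHull ℝ T) (hxr : l x = r) :
    x ∈ convexHull ℝ {t ∈ T | l t = r} := by
  have key : Convex ℝ {y | l y ≤ r ∧ (l y = r → y ∈ convexHull ℝ {t ∈ T | l t = r})} := by
    rw [convex_iff_forall_pos]
    rintro y ⟨hy, hy'⟩ z ⟨hz, hz'⟩ a b ha hb hab
    simp only [mem_ofPred_eq, map_add, map_smul, smul_eq_mul]
    have e : r = a * r + b * r := by rw [← add_mul, hab, one_mul]
    have h1 := mul_le_mul_of_nonneg_left hy ha.le
    have h2 := mul_le_mul_of_nonneg_left hz hb.le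
    refine ⟨by linarith, fun h => ?_⟩
    have h3 : a * l y = a * r := by linarith
    have h4 : b * l z = b * r := by linarith
    exact convex_convexHull ℝ _ (hy' (mul_left_cancel₀ ha.ne' h3))
      (hz' (mul_left_cancel₀ hb.ne' h4)) ha.le hb.le hab
  have hsub : T ⊆ {y | l y ≤ r ∧ (l y = r → y ∈ convexHull ℝ {t ∈ T | l t = r})} :=
    fun t ht => ⟨hl t ht, fun h => subset_convexHull ℝ _ ⟨ht, h⟩⟩
  exact (convexHull_min hsub key hx).2 hxr

/-- If an affine image of a point of `conv T` is extreme in a convex set containing the image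
of `T`, then it is already the image of a point of `T`. -/
lemma exists_mem_eq_of_mem_extremePoints {T K : Set E} (hK : Convex ℝ K) (f : E →ᵃ[ℝ] E)
    (hf : ∀ t ∈ T, f t ∈ K) {z : E} (hz : z ∈ convexHull ℝ T)
    (hfz : f z ∈ K.extremePoints ℝ) : ∃ t ∈ T, f t = f z := by
  have h1 : f z ∈ convexHull ℝ (f '' T) := by
    rw [← AffineMap.image_convexHull]; exact mem_image_of_mem _ hz
  have h2 : convexHull ℝ (f '' T) ⊆ K := convexHull_min (by rintro _ ⟨t, ht, rfl⟩; exact hf t ht) hK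
  have h3 := extremePoints_convexHull_subset
    (inter_extremePoints_subset_extremePoints_of_subset h2 ⟨h1, hfz⟩)
  exact h3

lemma left_mem_extremePoints_segment (x y : E) : x ∈ (segment ℝ x y).extremePoints ℝ := by
  rw [(convex_segment x y).mem_extremePoints_iff_mem_sdiff_convexHull_sdiff]
  refine ⟨left_mem_segment ℝ x y, fun h => ?_⟩
  by_cases hxy : x = y
  · subst hxy
    simp at h
  have key : Convex ℝ {z | ∃ t : ℝ, 0 < t ∧ z = x + t • (y - x)} := by
    rintro _ ⟨s, hs, rfl⟩ _ ⟨t, ht, rfl⟩ a b ha hb hab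
    refine ⟨a * s + b * t, ?_, ?_⟩
    · rcases ha.eq_or_lt with rfl | ha'
      · have : b = 1 := by linarith
        subst this; linarith
      · have := mul_pos ha' hs
        have := mul_nonneg hb ht.le
        linarith
    · obtain rfl : b = 1 - a := by linarith
      module
  obtain ⟨t, ht, h⟩ := convexHull_min (t := {z | ∃ t : ℝ, 0 < t ∧ z = x + t • (y - x)}) (by
    rintro z ⟨hz, hzx⟩
    rw [segment_eq_image'] at hz
    obtain ⟨t, ht, rfl⟩ := hz
    refine ⟨t, lt_of_le_of_ne ht.1 ?_, rfl⟩
    rintro rfl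
    simp at hzx) key h
  have : t • (y - x) = 0 := by simpa using h
  rcases smul_eq_zero.1 this with h | h
  · exact ht.ne' h
  · exact hxy (sub_eq_zero.1 h).symm

end Convex

section Lattice

variable {n : ℕ}

lemma toR_add (a b : Fin n → ℤ) : toR (a + b) = toR a + toR b := by ext; simp [toR]

lemma toR_sub (a b : Fin n → ℤ) : toR (a - b) = toR a - toR b := by ext; simp [toR]

lemma toR_smul (c : ℤ) (a : Fin n → ℤ) : toR (c • a) = (c : ℝ) • toR a := by ext; simp [toR]

lemma toR_nsmul (c : ℕ) (a : Fin n → ℤ) : toR (c • a) = (c : ℝ) • toR a := by ext; simp [toR]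

lemma toR_injective : Function.Injective (toR (n := n)) := fun a b h => by
  ext i
  have := congrFun h i
  simpa [toR] using this

lemma latticeLength_smul (c : ℤ) (v : Fin n → ℤ) :
    latticeLength (c • v) = c.natAbs * latticeLength v := by
  simp [latticeLength, Int.natAbs_mul, Finset.gcd_mul_left]

lemma latticeLength_sub_comm (a b : Fin n → ℤ) : latticeLength (a - b) = latticeLength (b - a) := by
  have h : a - b = (-1 : ℤ) • (b - a) := by simp
  rw [h, latticeLength_smul]
  simp

lemma latticeLength_ne_zero {v : Fin n → ℤ} (hv : v ≠ 0) : latticeLength v ≠ 0 := by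
  obtain ⟨i, hi⟩ := Function.ne_iff.1 hv
  exact Finset.gcd_ne_zero_iff.2 ⟨i, Finset.mem_univ i, by simpa using hi⟩

lemma latticeLength_smul_primVec (v : Fin n → ℤ) : (latticeLength v : ℤ) • primVec v = v := by
  ext i
  have : (latticeLength v : ℤ) ∣ v i :=
    Int.natCast_dvd.2 (Finset.gcd_dvd (f := fun i => (v i).natAbs) (Finset.mem_univ i))
  simpa [primVec] using Int.mul_ediv_cancel' this

lemma latticeLength_eq_one {v : Fin n → ℤ} {i : Fin n} (h : v i = 1) : latticeLength v = 1 := by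
  have : latticeLength v ∣ (v i).natAbs :=
    Finset.gcd_dvd (f := fun i => (v i).natAbs) (Finset.mem_univ i)
  simpa [h] using this

end Lattice

section Edge

variable {n : ℕ} {P : Set (Fin n → ℝ)} {a b : Fin n → ℤ}

lemma IsEdge.exists_dual (h : IsEdge P a b) : ∃ l : StrongDual ℝ (Fin n → ℝ),
    toR a ∈ P ∧ toR b ∈ P ∧ l (toR b) = l (toR a) ∧ (∀ x ∈ P, l x ≤ l (toR a)) ∧
      ∀ x ∈ P, l x = l (toR a) → x ∈ segment ℝ (toR a) (toR b) := by
  obtain ⟨l, hl⟩ := h.2 ⟨_, left_mem_segment ℝ _ _⟩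
  have ha : toR a ∈ {x ∈ P | ∀ y ∈ P, l y ≤ l x} := hl ▸ left_mem_segment ℝ _ _
  have hb : toR b ∈ {x ∈ P | ∀ y ∈ P, l y ≤ l x} := hl ▸ right_mem_segment ℝ _ _
  refine ⟨l, ha.1, hb.1, le_antisymm (ha.2 _ hb.1) (hb.2 _ ha.1), ha.2, fun x hx hxa => ?_⟩
  rw [hl]
  exact ⟨hx, fun y hy => hxa ▸ ha.2 y hy⟩

lemma isEdge_of_dual (hP : Convex ℝ P) (hab : a ≠ b) (l : StrongDual ℝ (Fin n → ℝ))
    (ha : toR a ∈ P) (hb : toR b ∈ P) (hl : l (toR b) = l (toR a)) (hle : ∀ x ∈ P, l x ≤ l (toR a))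
    (heq : ∀ x ∈ P, l x = l (toR a) → x ∈ segment ℝ (toR a) (toR b)) : IsEdge P a b := by
  refine ⟨hab, fun _ => ⟨l, Subset.antisymm ?_ ?_⟩⟩
  · intro x hx
    refine ⟨hP.segment_subset ha hb hx, fun y hy => ?_⟩
    obtain ⟨s, t, -, -, hst, rfl⟩ := hx
    have : l (s • toR a + t • toR b) = l (toR a) := by
      simp only [map_add, map_smul, hl, smul_eq_mul, ← add_mul, hst, one_mul]
    rw [this]
    exact hle y hy
  · rintro x ⟨hx, hx'⟩
    exact heq x hx (le_antisymm (hle x hx) (hx' _ ha))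

lemma IsEdge.symm (h : IsEdge P a b) : IsEdge P b a :=
  ⟨h.1.symm, segment_symm ℝ (toR a) (toR b) ▸ h.2⟩

lemma IsEdge.isVertex_left (h : IsEdge P a b) : IsVertex P (toR a) :=
  h.2.isExtreme.extremePoints_subset_extremePoints (left_mem_extremePoints_segment _ _)

/-- A linear functional that is nonnegative on all edge directions at a vertex of a lattice
polytope is minimal at that vertex. -/
lemma nonneg_of_nonneg_on_edges (hP : IsLatticePolytope P) {v : Fin n → ℤ}
    (hv : IsVertex P (toR v)) (g : StrongDual ℝ (Fin n → ℝ))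
    (hg : ∀ c, IsEdge P v c → 0 ≤ g (toR c - toR v)) {x : Fin n → ℝ} (hx : x ∈ P) :
    0 ≤ g (x - toR v) := by
  obtain ⟨S, rfl⟩ := hP
  set S' : Set (Fin n → ℝ) := toR '' (S : Set (Fin n → ℤ)) with hS'
  have hfin : S'.Finite := S.finite_toSet.image _
  obtain ⟨l, hl⟩ := exists_dual_lt_of_mem_extremePoints_convexHull hfin hv
  have hvS : toR v ∈ S' := extremePoints_convexHull_subset hv
  let L : StrongDual ℝ (Fin n → ℝ) := -l
  have hL : ∀ s ∈ S', s ≠ toR v → 0 < L (s - toR v) := fun s hs hsv => by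
    have := hl s hs hsv
    simp only [L, neg_apply, map_sub]
    linarith
  let φ : (Fin n → ℝ) → (Fin n → ℝ) := fun s => (L (s - toR v))⁻¹ • (s - toR v)
  let T : Set (Fin n → ℝ) := φ '' (S' \ {toR v})
  have hTfin : T.Finite := hfin.sdiff.image _
  have hLT : ∀ s ∈ S', s ≠ toR v → L (φ s) = 1 := fun s hs hsv => by
    simp only [φ, map_smul, smul_eq_mul]
    exact inv_mul_cancel₀ (hL s hs hsv).ne'
  have hφ : ∀ s ∈ S', s ≠ toR v → s = toR v + L (s - toR v) • φ s := fun s hs hsv => by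
    simp only [φ]
    rw [smul_smul, mul_inv_cancel₀ (hL s hs hsv).ne', one_smul]
    abel
  have hext : ∀ p ∈ (convexHull ℝ T).extremePoints ℝ, 0 ≤ g p := by
    intro p hp
    obtain ⟨m, hm⟩ := exists_dual_lt_of_mem_extremePoints_convexHull hTfin hp
    obtain ⟨s₀, ⟨hs₀, hs₀v⟩, hs₀p⟩ := extremePoints_convexHull_subset hp
    have hfin' : {s ∈ S' | s ≠ toR v ∧ φ s = p}.Finite := hfin.subset fun s hs => hs.1
    obtain ⟨c', ⟨hc', hc'v, hc'p⟩, hmax⟩ :=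
      hfin'.exists_maximalFor (fun s => L (s - toR v)) _ ⟨s₀, hs₀, hs₀v, hs₀p⟩
    have hmax' : ∀ s ∈ S', s ≠ toR v → φ s = p → L (s - toR v) ≤ L (c' - toR v) :=
      fun s hs hsv hsp => (le_total _ _).elim (fun h => hmax ⟨hs, hsv, hsp⟩ h) id
    obtain ⟨c, hcS, rfl⟩ := id hc'
    have hpc := hφ _ hc' hc'v
    rw [hc'p] at hpc
    have hpos := hL _ hc' hc'v
    let M : StrongDual ℝ (Fin n → ℝ) := m - m p • L
    have hMs : ∀ s ∈ S', s ≠ toR v → M s = M (toR v) + L (s - toR v) * (m (φ s) - m p) := by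
      intro s hs hsv
      have h1 : M (φ s) = m (φ s) - m p := by simp [M, hLT s hs hsv]
      conv_lhs => rw [hφ s hs hsv]
      rw [map_add, map_smul, h1, smul_eq_mul]
    have hMle : ∀ s ∈ S', M s ≤ M (toR v) ∧
        (M s = M (toR v) → s ∈ segment ℝ (toR v) (toR c)) := by
      intro s hs
      by_cases hsv : s = toR v
      · subst hsv
        exact ⟨le_rfl, fun _ => left_mem_segment ℝ _ _⟩
      have hLs := hL s hs hsv
      by_cases hsp : φ s = p
      · have h0 := hMs s hs hsv
        rw [hsp, sub_self, mul_zero, add_zero] at h0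
        refine ⟨h0.le, fun _ => ?_⟩
        rw [segment_eq_image']
        refine ⟨L (s - toR v) / L (toR c - toR v),
          ⟨by positivity, (div_le_one hpos).2 (hmax' s hs hsv hsp)⟩, ?_⟩
        have h1 : toR c - toR v = L (toR c - toR v) • p := by
          conv_lhs => rw [hpc]
          abel
        have h2 := hφ s hs hsv
        rw [hsp] at h2
        conv_rhs => rw [h2]
        simp only
        congr 1
        conv_lhs => arg 2; rw [h1]
        rw [smul_smul, div_mul_cancel₀ _ hpos.ne']
      · have h0 := hm (φ s) ⟨s, ⟨hs, hsv⟩, rfl⟩ hsp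
        have h1 : L (s - toR v) * (m (φ s) - m p) < 0 := mul_neg_of_pos_of_neg hLs (by linarith)
        have h2 := hMs s hs hsv
        exact ⟨by linarith, fun h => by linarith⟩
    have hMc : M (toR c) = M (toR v) := by
      rw [hMs _ hc' hc'v, hc'p]; ring
    have hedge : IsEdge (convexHull ℝ S') v c := by
      refine isEdge_of_dual (convex_convexHull ℝ S') ?_ M (subset_convexHull ℝ _ hvS)
        (subset_convexHull ℝ _ hc') hMc ?_ ?_
      · rintro rfl
        exact hc'v rfl
      · intro x hx
        exact convexHull_min (fun s hs => (hMle s hs).1)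
          (convex_halfSpace_le M.toLinearMap.isLinear (M (toR v))) hx
      · intro x hx hxv
        have := mem_convexHull_of_eq_of_le (l := M.toLinearMap) (fun s hs => (hMle s hs).1) hx hxv
        exact convexHull_min (fun s hs => (hMle s hs.1).2 hs.2) (convex_segment _ _) this
    have hgc := hg c hedge
    have : g (toR c - toR v) = L (toR c - toR v) * g p := by
      conv_lhs => rw [hpc]
      simp
    rw [this] at hgc
    exact nonneg_of_mul_nonneg_right hgc hpos
  have hT : ∀ t ∈ T, 0 ≤ g t := by
    intro t ht
    have h1 : t ∈ closure (convexHull ℝ ((convexHull ℝ T).extremePoints ℝ)) := by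
      rw [closure_convexHull_extremePoints (hTfin.isCompact_convexHull ℝ) (convex_convexHull ℝ T)]
      exact subset_convexHull ℝ T ht
    have h2 : IsClosed {y | 0 ≤ g y} := isClosed_le continuous_const g.continuous
    exact closure_minimal
      (convexHull_min hext (convex_halfSpace_ge g.toLinearMap.isLinear 0)) h2 h1
  have hS : ∀ s ∈ S', g (toR v) ≤ g s := by
    intro s hs
    by_cases hsv : s = toR v
    · rw [hsv]
    have h1 := hT (φ s) ⟨s, ⟨hs, hsv⟩, rfl⟩
    have h2 := mul_nonneg (hL s hs hsv).le h1
    have h3 : g s = g (toR v) + L (s - toR v) * g (φ s) := by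
      conv_lhs => rw [hφ s hs hsv]
      simp
    linarith
  have := convexHull_min hS (convex_halfSpace_ge g.toLinearMap.isLinear (g (toR v))) hx
  have h4 : g (toR v) ≤ g x := this
  rw [map_sub]
  linarith

end Edge

section Chart

variable {n k : ℕ} {P : Set (Fin n → ℝ)} {v : Fin n → ℤ}

lemma IsLatticePolytope.convex (hP : IsLatticePolytope P) : Convex ℝ P := by
  obtain ⟨S, rfl⟩ := hP
  exact convex_convexHull ℝ _

lemma IsLatticePolytope.isCompact (hP : IsLatticePolytope P) : IsCompact P := by
  obtain ⟨S, rfl⟩ := hP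
  exact (S.finite_toSet.image _).isCompact_convexHull ℝ

lemma IsLatticePolytope.exists_toR_eq (hP : IsLatticePolytope P) {x : Fin n → ℝ}
    (hx : IsVertex P x) : ∃ z, toR z = x := by
  obtain ⟨S, rfl⟩ := hP
  obtain ⟨z, -, hz⟩ := extremePoints_convexHull_subset hx
  exact ⟨z, hz⟩

lemma finite_preimage_toR_of_isCompact (hP : IsCompact P) : (toR ⁻¹' P).Finite := by
  obtain ⟨R, hR⟩ := hP.isBounded.exists_norm_le
  refine (Set.finite_Icc (fun _ => -⌈R⌉ : Fin n → ℤ) (fun _ => ⌈R⌉)).subset fun z hz => ?_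
  have h : ∀ i, |z i| ≤ ⌈R⌉ := fun i => by
    have h1 : |(z i : ℝ)| ≤ ⌈R⌉ := ((norm_le_pi_norm (toR z) i).trans (hR _ hz)).trans (Int.le_ceil R)
    exact_mod_cast h1
  exact ⟨fun i => (abs_le.1 (h i)).1, fun i => (abs_le.1 (h i)).2⟩

/-- A compact convex set with integral extreme points is a lattice polytope. -/
lemma isLatticePolytope_of_extremePoints (hc : IsCompact P) (hP : Convex ℝ P)
    (h : ∀ x ∈ P.extremePoints ℝ, ∃ z, toR z = x) : IsLatticePolytope P := by
  have hfin : {z : Fin n → ℤ | toR z ∈ P.extremePoints ℝ}.Finite :=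
    (finite_preimage_toR_of_isCompact hc).subset fun z hz => mem_preimage.2 (extremePoints_subset hz)
  have himg : toR '' {z : Fin n → ℤ | toR z ∈ P.extremePoints ℝ} = P.extremePoints ℝ := by
    ext x
    constructor
    · rintro ⟨z, hz, rfl⟩
      exact hz
    · intro hx
      obtain ⟨z, rfl⟩ := h x hx
      exact ⟨z, hx, rfl⟩
  refine ⟨hfin.toFinset, ?_⟩
  rw [Finite.coe_toFinset, himg]
  have hfin' : (P.extremePoints ℝ).Finite := himg ▸ hfin.image _
  rw [← (hfin'.isClosed_convexHull ℝ).closure_eq, closure_convexHull_extremePoints hc hP]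

lemma IsLatticePolytope.convexHull_extremePoints (hP : IsLatticePolytope P) :
    convexHull ℝ (P.extremePoints ℝ) = P := by
  have hfin : (P.extremePoints ℝ).Finite :=
    ((finite_preimage_toR_of_isCompact hP.isCompact).image toR).subset fun x hx => by
      obtain ⟨z, rfl⟩ := hP.exists_toR_eq hx
      exact ⟨z, mem_preimage.2 (extremePoints_subset hx), rfl⟩
  rw [← (hfin.isClosed_convexHull ℝ).closure_eq,
    closure_convexHull_extremePoints hP.isCompact hP.convex]

/-- Integral affine coordinates at a vertex `v` of a polytope in which the polytope lies in the
nonnegative orthant and contains an initial segment of length at least `k` of each axis,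
these segments being edges. -/
structure SmoothChart (P : Set (Fin n → ℝ)) (k : ℕ) (v : Fin n → ℤ) where
  /-- the primitive edge directions -/
  dir : Fin n → Fin n → ℤ
  /-- the lattice lengths of the edges -/
  len : Fin n → ℕ
  /-- the basis dual to the edge directions -/
  coord : Fin n → StrongDual ℝ (Fin n → ℝ)
  coord_int : ∀ i z, ∃ c : ℤ, coord i (toR z) = c
  coord_dir : ∀ i j, coord i (toR (dir j)) = if i = j then 1 else 0
  sum_coord : ∀ x, ∑ i, coord i x • toR (dir i) = x
  coord_nonneg : ∀ i, ∀ x ∈ P, 0 ≤ coord i (x - toR v)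
  le_len : ∀ i, k ≤ len i
  isEdge : ∀ i, IsEdge P v (v + len i • dir i)

lemma nonempty_smoothChart (hP : IsSmoothPolytope P) (hE : EdgesAtLeast P k)
    (hv : IsVertex P (toR v)) : Nonempty (SmoothChart P k v) := by
  obtain ⟨b, -, hb, hball, hdet⟩ := hP.2.2 v hv
  set M : Matrix (Fin n) (Fin n) ℤ := Matrix.of fun i => primVec (b i - v) with hM
  set N : Matrix (Fin n) (Fin n) ℤ := M⁻¹ with hN
  have hMN : M * N = 1 := Matrix.mul_nonsing_inv M hdet
  have hNM : N * M = 1 := Matrix.nonsing_inv_mul M hdet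
  have hbv : ∀ i, b i - v = latticeLength (b i - v) • M i := fun i => by
    have := latticeLength_smul_primVec (b i - v)
    rw [natCast_zsmul] at this
    exact this.symm
  let coord : Fin n → StrongDual ℝ (Fin n → ℝ) := fun i =>
    LinearMap.toContinuousLinearMap (∑ j, (N j i : ℝ) • LinearMap.proj j)
  have hcoord : ∀ i x, coord i x = ∑ j, (N j i : ℝ) * x j := fun i x => by simp [coord]
  have hdir : ∀ i j, coord i (toR (M j)) = if i = j then 1 else 0 := fun i j => by
    have h1 : (M * N) j i = if j = i then 1 else 0 := by rw [hMN, Matrix.one_apply]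
    rw [Matrix.mul_apply] at h1
    have h2 : ((∑ l, M j l * N l i : ℤ) : ℝ) = ((if j = i then 1 else 0 : ℤ) : ℝ) := by rw [h1]
    push_cast at h2
    rw [hcoord]
    simp only [toR]
    rw [show (if i = j then (1 : ℝ) else 0) = if j = i then 1 else 0 by simp only [eq_comm], ← h2]
    exact Finset.sum_congr rfl fun l _ => mul_comm _ _
  refine ⟨⟨fun i => M i, fun i => latticeLength (b i - v), coord, fun i z => ?_, hdir, fun x => ?_,
    fun i x hx => ?_, fun i => hE _ _ (hb i), fun i => ?_⟩⟩
  · exact ⟨∑ j, N j i * z j, by rw [hcoord]; simp [toR]⟩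
  · ext l
    simp only [Finset.sum_apply, Pi.smul_apply, smul_eq_mul, hcoord, Finset.sum_mul, toR]
    rw [Finset.sum_comm]
    have : ∀ j, ∑ i, (N j i : ℝ) * x j * (M i l : ℝ) = if j = l then x j else 0 := fun j => by
      have h1 : (N * M) j l = if j = l then 1 else 0 := by rw [hNM, Matrix.one_apply]
      rw [Matrix.mul_apply] at h1
      have h2 : ((∑ i, N j i * M i l : ℤ) : ℝ) = ((if j = l then 1 else 0 : ℤ) : ℝ) := by rw [h1]
      push_cast at h2
      calc ∑ i, (N j i : ℝ) * x j * (M i l : ℝ) = x j * ∑ i, (N j i : ℝ) * (M i l : ℝ) := by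
            rw [Finset.mul_sum]; exact Finset.sum_congr rfl fun i _ => by ring
        _ = _ := by rw [h2]; simp
    simp [this]
  · refine nonneg_of_nonneg_on_edges hP.1 hv _ (fun c hc => ?_) hx
    obtain ⟨j, hj⟩ := hball c hc
    have : toR c ∈ segment ℝ (toR v) (toR (b j)) := hj ▸ right_mem_segment ℝ _ _
    rw [segment_eq_image'] at this
    obtain ⟨t, ht, htc⟩ := this
    have h1 : toR c - toR v = t • (toR (b j) - toR v) := by
      rw [← htc]; simp
    rw [h1, ← toR_sub, hbv, toR_nsmul, map_smul, map_smul, hdir]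
    have := ht.1
    simp only [smul_eq_mul]
    split_ifs <;> positivity
  · have : v + latticeLength (b i - v) • M i = b i := by rw [← hbv]; abel
    rw [this]
    exact hb i

namespace SmoothChart

variable (C : SmoothChart P k v)

include C in
lemma vertex_mem (i : Fin n) : toR v ∈ P := extremePoints_subset (C.isEdge i).isVertex_left

lemma add_smul_dir_mem (hP : Convex ℝ P) (i : Fin n) {t : ℝ} (h0 : 0 ≤ t) (h1 : t ≤ C.len i) :
    toR v + t • toR (C.dir i) ∈ P := by
  have hv := extremePoints_subset (C.isEdge i).isVertex_left
  have hw := extremePoints_subset (C.isEdge i).symm.isVertex_left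
  rcases h0.eq_or_lt with rfl | h0
  · simpa using hv
  have hl : (0 : ℝ) < C.len i := h0.trans_le h1
  have := hP.add_smul_sub_mem hv hw (t := t / C.len i) ⟨by positivity, (div_le_one hl).2 h1⟩
  rwa [toR_add, toR_nsmul, add_sub_cancel_left, smul_smul, div_mul_cancel₀ _ hl.ne'] at this

lemma add_smul_dir_mem_of_le (hP : Convex ℝ P) (i : Fin n) {t : ℝ} (h0 : 0 ≤ t) (h1 : t ≤ k) :
    toR v + t • toR (C.dir i) ∈ P :=
  C.add_smul_dir_mem hP i h0 (h1.trans (by exact_mod_cast C.le_len i))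

/-- The polytope contains a neighbourhood of `v` in its tangent cone. -/
lemma exists_add_smul_mem (hn : 0 < n) (hk : 1 ≤ k) (hP : Convex ℝ P) (w : Fin n → ℝ)
    (hw : ∀ i, 0 ≤ C.coord i w) : ∃ ε : ℝ, 0 < ε ∧ toR v + ε • w ∈ P := by
  set D := 1 + ∑ i, C.coord i w with hD
  have hD0 : 0 < D := by
    have := Finset.sum_nonneg fun i (_ : i ∈ Finset.univ) => hw i
    linarith
  have hn' : (0 : ℝ) < n := by exact_mod_cast hn
  refine ⟨1 / (n * D), by positivity, ?_⟩
  have h1 := hP.sum_mem (t := Finset.univ) (w := fun _ : Fin n => 1 / (n : ℝ))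
    (z := fun i => toR v + (C.coord i w / D) • toR (C.dir i)) (fun _ _ => by positivity)
    (by simp [hn'.ne']) (fun i _ => C.add_smul_dir_mem_of_le hP i (div_nonneg (hw i) hD0.le) (by
      have h2 := Finset.single_le_sum (fun i (_ : i ∈ Finset.univ) => hw i) (Finset.mem_univ i)
      have h3 : C.coord i w / D ≤ 1 := (div_le_one hD0).2 (by linarith)
      have h4 : (1 : ℝ) ≤ k := by exact_mod_cast hk
      linarith))
  convert h1 using 1
  simp only [smul_add, Finset.sum_add_distrib, Finset.sum_const, Finset.card_univ,
    Fintype.card_fin, ← Nat.cast_smul_eq_nsmul ℝ, smul_smul]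
  rw [mul_one_div_cancel hn'.ne', one_smul]
  congr 1
  conv_lhs => rw [← C.sum_coord w]
  rw [Finset.smul_sum]
  refine Finset.sum_congr rfl fun i _ => ?_
  rw [smul_smul]
  congr 1
  field_simp

end SmoothChart

end Chart

section Facet

variable {n k : ℕ} {P : Set (Fin n → ℝ)} {i : Fin n}

/-- A functional that is constant on a facet contained in a coordinate hyperplane is a multiple
of the corresponding coordinate. -/
lemma IsFacet.apply_eq_mul (hF : IsFacet P (P ∩ {x | x i = 0})) (f : StrongDual ℝ (Fin n → ℝ))
    (hf : ∀ x ∈ P, x i = 0 → ∀ y ∈ P, y i = 0 → f x = f y) (x : Fin n → ℝ) :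
    f x = f (Pi.single i 1) * x i := by
  set F := P ∩ {x | x i = 0}
  have hdim := hF.2
  rw [direction_affineSpan] at hdim
  let p : (Fin n → ℝ) →ₗ[ℝ] ℝ := LinearMap.proj i
  have h1 : vectorSpan ℝ F ≤ p.ker := by
    rw [vectorSpan_def, Submodule.span_le]
    rintro _ ⟨a, ha, b, hb, rfl⟩
    have ha' : a i = 0 := ha.2
    have hb' : b i = 0 := hb.2
    simp [p, ha', hb']
  have h2 : vectorSpan ℝ F ≤ (f : (Fin n → ℝ) →ₗ[ℝ] ℝ).ker := by
    rw [vectorSpan_def, Submodule.span_le]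
    rintro _ ⟨a, ha, b, hb, rfl⟩
    have := hf a ha.1 ha.2 b hb.1 hb.2
    simp [this]
  have h3 : Module.finrank ℝ p.ker < n := by
    have : p.ker < ⊤ := by
      rw [lt_top_iff_ne_top]
      intro h
      have : Pi.single i (1 : ℝ) ∈ p.ker := h ▸ Submodule.mem_top
      simp [p] at this
    simpa using Submodule.finrank_lt_finrank_of_lt this
  have h4 : vectorSpan ℝ F = p.ker := Submodule.eq_of_le_of_finrank_le h1 (by omega)
  have h5 : x - x i • Pi.single i (1 : ℝ) ∈ p.ker := by simp [p]
  have h6 : f (x - x i • Pi.single i (1 : ℝ)) = 0 := h2 (h4 ▸ h5)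
  rw [map_sub, map_smul, smul_eq_mul] at h6
  linarith

lemma CanonicallyPositioned.apply_nonneg (hpos : CanonicallyPositioned P)
    (hF : IsFacet P (P ∩ {x | x i = 0})) {x : Fin n → ℝ} (hx : x ∈ P) : 0 ≤ x i := by
  have h0 : (0 : Fin n → ℝ) ∈ P := extremePoints_subset hpos.1
  have h0F : (0 : Fin n → ℝ) ∈ P ∩ {x | x i = 0} := ⟨h0, rfl⟩
  obtain ⟨l, hl⟩ := hF.1 ⟨0, h0F⟩
  have hmax : ∀ y ∈ P, y i = 0 → ∀ z ∈ P, l z ≤ l y := fun y hy hyi => by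
    have : y ∈ {x ∈ P | ∀ y ∈ P, l y ≤ l x} := hl ▸ ⟨hy, hyi⟩
    exact this.2
  have hlx := hF.apply_eq_mul l fun y hy hyi z hz hzi =>
    le_antisymm (hmax z hz hzi y hy) (hmax y hy hyi z hz)
  obtain ⟨a, b, hab, hsub⟩ := hpos.2 i
  have ⟨y, hyP, hy⟩ : ∃ y ∈ P, 0 < y i := by
    by_contra! hcon
    have haP := extremePoints_subset hab.isVertex_left
    have hbP := extremePoints_subset hab.symm.isVertex_left
    have ha := hsub (left_mem_segment ℝ _ _)
    have hb := hsub (right_mem_segment ℝ _ _)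
    refine hab.1 (toR_injective ?_)
    ext j
    by_cases hj : j = i
    · subst hj
      rw [le_antisymm (hcon _ haP) ha.1, le_antisymm (hcon _ hbP) hb.1]
    · rw [ha.2 j hj, hb.2 j hj]
  have hneg : l (Pi.single i 1) < 0 := by
    have h1 := hmax 0 h0 rfl y hyP
    rw [map_zero, hlx] at h1
    rcases lt_trichotomy (l (Pi.single i 1)) 0 with h | h | h
    · exact h
    · exfalso
      have : y ∈ P ∩ {x | x i = 0} := by
        rw [hl]
        refine ⟨hyP, fun z _ => ?_⟩
        rw [hlx z, hlx y, h]
        simp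
      exact hy.ne' this.2
    · have := mul_pos h hy
      linarith
  have h1 := hmax 0 h0 rfl x hx
  rw [map_zero, hlx] at h1
  by_contra! h
  have := mul_pos_of_neg_of_neg hneg h
  linarith

/-- At a vertex on the facet `xᵢ = 0`, the `i`-th coordinate is one of the chart coordinates. -/
lemma SmoothChart.exists_coord_eq {v : Fin n → ℤ} (C : SmoothChart P k v) (hk : 1 ≤ k)
    (hP : Convex ℝ P) (hnn : ∀ x ∈ P, 0 ≤ x i) (hF : IsFacet P (P ∩ {x | x i = 0}))
    (hv : v i = 0) : ∃ j, ∀ x, C.coord j x = x i := by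
  have hvi : toR v i = 0 := by simp [toR, hv]
  have hvP := C.vertex_mem i
  have hdnn : ∀ j, 0 ≤ C.dir j i := fun j => by
    have := hnn _ (C.add_smul_dir_mem_of_le hP j zero_le_one (by exact_mod_cast hk))
    rw [one_smul, Pi.add_apply, hvi, zero_add] at this
    simpa [toR] using this
  have hsum : ∀ x : Fin n → ℝ, ∑ j, C.coord j x * (C.dir j i : ℝ) = x i := fun x => by
    conv_rhs => rw [← C.sum_coord x]
    simp [toR]
  obtain ⟨j, hj⟩ : ∃ j, C.dir j i ≠ 0 := by
    by_contra! h
    have := hsum (Pi.single i 1)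
    simp [h] at this
  have hzero : ∀ x ∈ P, x i = 0 → C.coord j (x - toR v) = 0 := fun x hx hxi => by
    have h1 := hsum (x - toR v)
    rw [Pi.sub_apply, hxi, hvi, sub_zero] at h1
    have h2 := (Finset.sum_eq_zero_iff_of_nonneg fun r _ =>
      mul_nonneg (C.coord_nonneg r x hx) (by exact_mod_cast hdnn r)).1 h1 j (Finset.mem_univ j)
    exact (mul_eq_zero.1 h2).resolve_right (by exact_mod_cast hj)
  have hlin := hF.apply_eq_mul (C.coord j) fun x hx hxi y hy hyi => by
    have h1 := hzero x hx hxi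
    have h2 := hzero y hy hyi
    rw [map_sub] at h1 h2
    linarith
  obtain ⟨c, hc⟩ := C.coord_int j (Pi.single i 1)
  have hs : toR (Pi.single i 1) = Pi.single i (1 : ℝ) := by
    ext l
    by_cases h : l = i
    · subst h; simp [toR]
    · simp [toR, h]
  rw [hs] at hc
  have h1 := hlin (toR (C.dir j))
  rw [C.coord_dir, if_pos rfl, hc] at h1
  have h2 : c * C.dir j i = 1 := by
    simp only [toR] at h1
    exact_mod_cast h1.symm
  have h3 : C.dir j i = 1 := Int.eq_one_of_dvd_one (hdnn j) (Dvd.intro_left c h2)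
  rw [h3, mul_one] at h2
  refine ⟨j, fun x => ?_⟩
  rw [hlin, hc, h2]
  simp

end Facet

section Slice

variable {n k : ℕ} {P : Set (Fin n → ℝ)} {i : Fin n}

lemma Convex.slice (hP : Convex ℝ P) : Convex ℝ (P ∩ {x | 1 ≤ x i}) :=
  hP.inter (convex_halfSpace_ge (LinearMap.proj (R := ℝ) (φ := fun _ : Fin n => ℝ) i).isLinear 1)

/-- Near a point of height greater than one, the truncation agrees with the polytope. -/
lemma exists_add_smul_mem_slice (hP : Convex ℝ P) {p x : Fin n → ℝ} (hp : p ∈ P) (hpi : 1 < p i)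
    (hx : x ∈ P) : ∃ ε₀ : ℝ, 0 < ε₀ ∧
      ∀ ε : ℝ, 0 ≤ ε → ε ≤ ε₀ → p + ε • (x - p) ∈ P ∩ {x | 1 ≤ x i} := by
  have hd : 0 < |x i - p i| + 1 := by positivity
  have hpi' : 0 < p i - 1 := by linarith
  refine ⟨min 1 ((p i - 1) / (|x i - p i| + 1)), by positivity, fun ε h0 h1 => ?_⟩
  refine ⟨hP.add_smul_sub_mem hp hx ⟨h0, h1.trans (min_le_left _ _)⟩, ?_⟩
  have h2 : ε * (|x i - p i| + 1) ≤ p i - 1 := (le_div_iff₀ hd).1 (h1.trans (min_le_right _ _))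
  have h3 := mul_le_mul_of_nonneg_left (neg_abs_le (x i - p i)) h0
  simp only [mem_ofPred_eq, Pi.add_apply, Pi.smul_apply, Pi.sub_apply, smul_eq_mul]
  linarith

lemma mem_extremePoints_of_slice (hP : Convex ℝ P) {p : Fin n → ℝ}
    (hp : p ∈ (P ∩ {x | 1 ≤ x i}).extremePoints ℝ) (hpi : 1 < p i) : p ∈ P.extremePoints ℝ := by
  rw [mem_extremePoints_iff_left] at hp ⊢
  refine ⟨hp.1.1, fun x hx y hy hxy => ?_⟩
  obtain ⟨ε₁, h1, hε₁⟩ := exists_add_smul_mem_slice hP hp.1.1 hpi hx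
  obtain ⟨ε₂, h2, hε₂⟩ := exists_add_smul_mem_slice hP hp.1.1 hpi hy
  have hε : 0 < min ε₁ ε₂ := lt_min h1 h2
  have h := hp.2 _ (hε₁ (min ε₁ ε₂) hε.le (min_le_left _ _)) _
    (hε₂ (min ε₁ ε₂) hε.le (min_le_right _ _)) (by
      obtain ⟨a, b, ha, hb, hab, hxy⟩ := hxy
      refine ⟨a, b, ha, hb, hab, ?_⟩
      calc _ = (a + b) • p + min ε₁ ε₂ • ((a • x + b • y) - (a + b) • p) := by module
        _ = p := by rw [hxy, hab]; simp)
  have h3 : min ε₁ ε₂ • (x - p) = 0 := by simpa using h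
  exact sub_eq_zero.1 ((smul_eq_zero.1 h3).resolve_left hε.ne')

/-- A vertex of the truncation on the cutting hyperplane is a vertex of `P` or the lattice point
next to a vertex on the facet along the unique edge leaving that facet. -/
lemma mem_extremePoints_slice_of_eq_one (hP : IsSmoothPolytope P) (hk : 1 ≤ k)
    (hE : EdgesAtLeast P k) (hpos : CanonicallyPositioned P) (hF : IsFacet P (P ∩ {x | x i = 0}))
    {p : Fin n → ℝ} (hp : p ∈ (P ∩ {x | 1 ≤ x i}).extremePoints ℝ) (hpi : p i = 1) :
    p ∈ P.extremePoints ℝ ∨ ∃ (v : Fin n → ℤ) (C : SmoothChart P k v) (j : Fin n),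
      v i = 0 ∧ (∀ x, C.coord j x = x i) ∧ p = toR v + toR (C.dir j) := by
  have hconv := hP.1.convex
  have hnn : ∀ x ∈ P, 0 ≤ x i := fun x hx => hpos.apply_nonneg hF hx
  set S₀ := {x ∈ P.extremePoints ℝ | x i = 0}
  set S₁ := {x ∈ P.extremePoints ℝ | 1 ≤ x i}
  have hS : P.extremePoints ℝ = S₀ ∪ S₁ := by
    ext x
    refine ⟨fun hx => ?_, fun hx => hx.elim (fun h => h.1) fun h => h.1⟩
    obtain ⟨z, rfl⟩ := hP.1.exists_toR_eq hx
    have h0 : 0 ≤ z i := by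
      have := hnn _ (extremePoints_subset hx)
      simpa [toR] using this
    rcases h0.eq_or_lt with h | h
    · exact Or.inl ⟨hx, by simp [toR, ← h]⟩
    · refine Or.inr ⟨hx, ?_⟩
      simp only [toR]
      exact_mod_cast h
  have hS₀ : S₀.Nonempty := ⟨0, hpos.1, rfl⟩
  have hpP : p ∈ convexHull ℝ (S₀ ∪ S₁) := by
    rw [← hS, hP.1.convexHull_extremePoints]
    exact hp.1.1
  have hlev : ∀ z ∈ convexHull ℝ S₀, z i = 0 := fun z hz =>
    convexHull_min (fun x hx => hx.2) (convex_hyperplane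
      (LinearMap.proj (R := ℝ) (φ := fun _ : Fin n => ℝ) i).isLinear 0) hz
  have hS₁ : S₁.Nonempty := by
    rw [nonempty_iff_ne_empty]
    intro h
    rw [h, union_empty] at hpP
    have := hlev p hpP
    linarith
  rw [convexHull_union hS₀ hS₁, mem_convexJoin] at hpP
  obtain ⟨z, hz, y, hy, a, b, ha, hb, hab, hzy⟩ := hpP
  have hS₁P : S₁ ⊆ P ∩ {x | 1 ≤ x i} := fun x hx => ⟨extremePoints_subset hx.1, hx.2⟩
  have hyP' : y ∈ P ∩ {x | 1 ≤ x i} := convexHull_min hS₁P hconv.slice hy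
  have hyi : 1 ≤ y i := hyP'.2
  have hby : b * y i = 1 := by
    have := congrFun hzy i
    simpa [hlev z hz, hpi] using this
  let f : (Fin n → ℝ) →ᵃ[ℝ] (Fin n → ℝ) :=
    a • AffineMap.id ℝ (Fin n → ℝ) + AffineMap.const ℝ (Fin n → ℝ) (b • y)
  have hf : ∀ x, f x = a • x + b • y := fun x => by simp [f]
  obtain ⟨v', hv', hv'p⟩ := exists_mem_eq_of_mem_extremePoints (hconv.slice (i := i)) f (fun x hx => by
    rw [hf]
    refine ⟨hconv (extremePoints_subset hx.1) hyP'.1 ha hb hab, ?_⟩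
    have : x i = 0 := hx.2
    simp [this, hby]) hz (by rw [hf, hzy]; exact hp)
  rw [hf, hf, hzy] at hv'p
  rcases hyi.eq_or_lt with h1 | h1
  · left
    have hb1 : b = 1 := by rw [← h1] at hby; linarith
    have ha0 : a = 0 := by linarith
    have hyp : y = p := by simpa [ha0, hb1] using hzy
    obtain ⟨t, ht, hty⟩ := exists_mem_eq_of_mem_extremePoints (hconv.slice (i := i))
      (AffineMap.id ℝ (Fin n → ℝ)) hS₁P hy
      (by simpa [hyp] using hp)
    have hty' : t = y := hty
    rw [← hyp, ← hty']
    exact ht.1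
  · right
    obtain ⟨v, rfl⟩ := hP.1.exists_toR_eq hv'.1
    have hvi : v i = 0 := by
      have := hv'.2
      simpa [toR] using this
    have hvi' : toR v i = 0 := hv'.2
    obtain ⟨C⟩ := nonempty_smoothChart hP hE hv'.1
    obtain ⟨j, hj⟩ := C.exists_coord_eq hk hconv hnn hF hvi
    refine ⟨v, C, j, hvi, hj, ?_⟩
    have hui : toR (C.dir j) i = 1 := by rw [← hj (toR _), C.coord_dir, if_pos rfl]
    set w := y - toR v - y i • toR (C.dir j) with hw
    have hwi : w i = 0 := by simp [w, hvi', hui]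
    obtain ⟨ε, hε, hεP⟩ := C.exists_add_smul_mem i.pos hk hconv w (fun r => by
      by_cases hr : r = j
      · rw [hr, hj, hwi]
      · rw [hw, map_sub, map_smul, C.coord_dir, if_neg hr, smul_zero, sub_zero]
        exact C.coord_nonneg r y hyP'.1)
    have hb1 : b < 1 := by
      by_contra! h
      have := mul_lt_mul_of_pos_left h1 (zero_lt_one.trans_le h)
      linarith
    have ha0 : 0 < a := by linarith
    have hb0 : 0 < b := by
      rcases hb.eq_or_lt with h | h
      · rw [← h, zero_mul] at hby
        exact absurd hby zero_ne_one
      · exact h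
    have hq₀ : toR v + toR (C.dir j) ∈ P ∩ {x | 1 ≤ x i} := by
      have := C.add_smul_dir_mem_of_le hconv j zero_le_one (by exact_mod_cast hk)
      rw [one_smul] at this
      exact ⟨this, by simp [hvi', hui]⟩
    have hq₁ : a • (toR v + ε • w) + b • y ∈ P ∩ {x | 1 ≤ x i} :=
      ⟨hconv hεP hyP'.1 ha hb hab, by simp [hvi', hwi, hby]⟩
    have hD : 0 < b + a * ε := by positivity
    refine ((mem_extremePoints_iff_left.1 hp).2 _ hq₀ _ hq₁
      ⟨a * ε / (b + a * ε), b / (b + a * ε), by positivity, by positivity, by field_simp; ring,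
        ?_⟩).symm
    have hyw : y = toR v + y i • toR (C.dir j) + w := by rw [hw]; abel
    have hbyw : b • y = b • toR v + toR (C.dir j) + b • w := by
      conv_lhs => rw [hyw]
      rw [smul_add, smul_add, smul_smul, hby, one_smul]
    rw [← hv'p, hbyw]
    obtain rfl : a = 1 - b := by linarith
    ext r
    simp only [Pi.add_apply, Pi.smul_apply, smul_eq_mul]
    field_simp
    ring

lemma isLatticePolytope_slice (hP : IsSmoothPolytope P) (hk : 1 ≤ k)
    (hE : EdgesAtLeast P k) (hpos : CanonicallyPositioned P)
    (hF : IsFacet P (P ∩ {x | x i = 0})) : IsLatticePolytope (P ∩ {x | 1 ≤ x i}) := by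
  refine isLatticePolytope_of_extremePoints
    (hP.1.isCompact.inter_right (isClosed_le continuous_const (continuous_apply i)))
    hP.1.convex.slice fun p hp => ?_
  have hpi : 1 ≤ p i := hp.1.2
  rcases hpi.eq_or_lt with h | h
  · rcases mem_extremePoints_slice_of_eq_one hP hk hE hpos hF hp h.symm with
      h1 | ⟨v, C, j, -, -, rfl⟩
    · exact hP.1.exists_toR_eq h1
    · exact ⟨v + C.dir j, toR_add _ _⟩
  · exact hP.1.exists_toR_eq (mem_extremePoints_of_slice hP.1.convex hp h)

lemma apply_ne_one_of_isVertex (hP : IsSmoothPolytope P) (hk : 2 ≤ k) (hE : EdgesAtLeast P k)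
    (hpos : CanonicallyPositioned P) (hF : IsFacet P (P ∩ {x | x i = 0})) {p : Fin n → ℝ}
    (hp : p ∈ P.extremePoints ℝ) : p i ≠ 1 := by
  intro hpi
  obtain ⟨s, rfl⟩ := hP.1.exists_toR_eq hp
  obtain ⟨C⟩ := nonempty_smoothChart hP hE hp
  have hnn : ∀ x ∈ P, 0 ≤ x i := fun x hx => hpos.apply_nonneg hF hx
  have hsum := congrFun (C.sum_coord (0 - toR s)) i
  simp only [Finset.sum_apply, Pi.smul_apply, Pi.sub_apply, Pi.zero_apply, hpi, smul_eq_mul] at hsum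
  obtain ⟨r, hr⟩ : ∃ r, C.dir r i < 0 := by
    by_contra! h
    have : 0 ≤ ∑ r, C.coord r (0 - toR s) * toR (C.dir r) i :=
      Finset.sum_nonneg fun r _ => mul_nonneg (C.coord_nonneg r 0 (extremePoints_subset hpos.1))
        (by simp only [toR]; exact_mod_cast h r)
    linarith
  have h1 := hnn _ (C.add_smul_dir_mem_of_le hP.1.convex r (Nat.cast_nonneg k) le_rfl)
  rw [Pi.add_apply, hpi, Pi.smul_apply, smul_eq_mul] at h1
  have h2 : (C.dir r i : ℝ) ≤ -1 := by exact_mod_cast Int.le_sub_one_of_lt hr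
  have h3 : (2 : ℝ) ≤ k := by exact_mod_cast hk
  simp only [toR] at h1
  nlinarith

end Slice

section SliceEdge

variable {n k : ℕ} {P : Set (Fin n → ℝ)} {i : Fin n} {a b : Fin n → ℤ}

/-- An edge of the truncation with an endpoint off the cutting hyperplane is an edge of `P`,
possibly shortened by one. -/
lemma IsEdge.le_latticeLength_of_one_lt (hP : IsLatticePolytope P) (hE : EdgesAtLeast P k)
    (hnn : ∀ x ∈ P, 0 ≤ x i) (h : IsEdge (P ∩ {x | 1 ≤ x i}) a b) (hb : 1 < b i) :
    k - 1 ≤ latticeLength (b - a) := by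
  have hconv := hP.convex
  obtain ⟨l, haP, hbP, hlb, hle, heq⟩ := h.exists_dual
  have hbi : (1 : ℝ) < toR b i := by simp only [toR]; exact_mod_cast hb
  have hray : ∀ x ∈ P, l x ≤ l (toR a) ∧
      (l x = l (toR a) → ∃ t : ℝ, 0 ≤ t ∧ x = toR b + t • (toR a - toR b)) := by
    intro x hx
    obtain ⟨ε, hε, hmem⟩ := exists_add_smul_mem_slice hconv hbP.1 hbi hx
    have hq := hmem ε hε.le le_rfl
    have hlq : l (toR b + ε • (x - toR b)) = l (toR a) + ε * (l x - l (toR a)) := by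
      simp [hlb]
    constructor
    · have h1 := hle _ hq
      rw [hlq] at h1
      by_contra! h2
      have := mul_pos hε (sub_pos.2 h2)
      linarith
    · intro hlx
      have h1 := heq _ hq (by rw [hlq, hlx, sub_self, mul_zero, add_zero])
      rw [segment_symm, segment_eq_image'] at h1
      obtain ⟨t, ht, h1⟩ := h1
      refine ⟨t / ε, div_nonneg ht.1 hε.le, ?_⟩
      have h2 : t • (toR a - toR b) = ε • (x - toR b) := add_left_cancel h1
      rw [div_eq_inv_mul, mul_smul, h2, smul_smul, inv_mul_cancel₀ hε.ne', one_smul]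
      abel
  by_cases hG : ∀ x ∈ P.extremePoints ℝ, l x = l (toR a) → 1 ≤ x i
  · have hedge : IsEdge P a b := by
      refine isEdge_of_dual hconv h.1 l haP.1 hbP.1 hlb (fun x hx => (hray x hx).1)
        fun x hx hlx => heq x ⟨hx, ?_⟩ hlx
      have hx' : x ∈ convexHull ℝ (P.extremePoints ℝ) := by rwa [hP.convexHull_extremePoints]
      have h1 := mem_convexHull_of_eq_of_le (l := l.toLinearMap)
        (fun t ht => (hray t (extremePoints_subset ht)).1) hx' hlx
      exact convexHull_min (fun t ht => hG t ht.1 ht.2) (convex_halfSpace_ge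
        (LinearMap.proj (R := ℝ) (φ := fun _ : Fin n => ℝ) i).isLinear 1) h1
    exact (Nat.sub_le k 1).trans (hE _ _ hedge)
  · push Not at hG
    obtain ⟨s, hs, hls, hsi⟩ := hG
    have hsP := extremePoints_subset hs
    obtain ⟨z, rfl⟩ := hP.exists_toR_eq hs
    have hz : z i = 0 := by
      have h0 := hnn _ hsP
      simp only [toR] at h0 hsi
      norm_cast at h0 hsi
      omega
    have hzi : toR z i = 0 := by simp [toR, hz]
    set β := toR b i with hβ
    have hβ0 : 0 < β := by linarith
    have hβ1 : 1 / β < 1 := (div_lt_one hβ0).2 hbi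
    have hβ2 : 0 < 1 / β := by positivity
    have hq : toR b + (1 - 1 / β) • (toR z - toR b) ∈ P ∩ {x | 1 ≤ x i} := by
      refine ⟨hconv.add_smul_sub_mem hbP.1 hsP ⟨by linarith, by linarith⟩, ?_⟩
      simp only [mem_ofPred_eq, Pi.add_apply, Pi.smul_apply, Pi.sub_apply, smul_eq_mul, hzi, ← hβ]
      field_simp
      linarith
    have hqa : toR b + (1 - 1 / β) • (toR z - toR b) = toR a ∧ toR a i = 1 := by
      have h1 := heq _ hq (by simp [hlb, hls])
      rw [segment_symm, segment_eq_image'] at h1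
      obtain ⟨t, ht, h1⟩ := h1
      have h2 := congrFun h1 i
      simp only [Pi.add_apply, Pi.smul_apply, Pi.sub_apply, smul_eq_mul, hzi, ← hβ] at h2
      have h3 : β + (1 - 1 / β) * (0 - β) = 1 := by field_simp; ring
      rw [h3] at h2
      have hai : 1 ≤ toR a i := haP.2
      have h4 := mul_nonneg ht.1 (sub_nonneg.2 hai)
      have h5 : t = 1 := by
        by_contra hne
        have := mul_pos (sub_pos.2 (lt_of_le_of_ne ht.2 hne)) (sub_pos.2 hbi)
        linarith
      subst h5
      refine ⟨by rw [← h1]; simp, by linarith⟩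
    have hab : toR a - toR b = (1 - 1 / β) • (toR z - toR b) := by rw [← hqa.1]; abel
    have hedge : IsEdge P z b := by
      refine isEdge_of_dual hconv (fun h => by rw [h] at hz; omega) l hsP hbP.1 (by rw [hlb, hls])
        (fun x hx => hls ▸ (hray x hx).1) fun x hx hlx => ?_
      obtain ⟨t, ht, hxt⟩ := (hray x hx).2 (hlx.trans hls)
      have hxi := hnn x hx
      rw [segment_symm, segment_eq_image']
      refine ⟨t * (1 - 1 / β), ⟨mul_nonneg ht (by linarith), ?_⟩, ?_⟩
      · rw [hxt] at hxi
        simp only [Pi.add_apply, Pi.smul_apply, Pi.sub_apply, smul_eq_mul, hqa.2, ← hβ] at hxi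
        have : t * (1 - 1 / β) = t * (β - 1) / β := by field_simp
        rw [this, div_le_one hβ0]
        linarith
      · simp only
        rw [hxt, hab, smul_smul]
    have hbz : b - z = b i • (a - z) := by
      apply toR_injective
      rw [toR_smul, toR_sub, toR_sub, ← hqa.1]
      change _ = β • _
      ext r
      simp only [Pi.add_apply, Pi.smul_apply, Pi.sub_apply, smul_eq_mul]
      field_simp
      ring
    have haz : (a - z) i = 1 := by
      have := hqa.2
      simp only [toR] at this
      norm_cast at this
      rw [Pi.sub_apply, this, hz, sub_zero]
    have hba : b - a = (b i - 1) • (a - z) := by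
      rw [sub_smul, ← hbz, one_smul]
      abel
    have hlen := hE _ _ hedge
    rw [hbz, latticeLength_smul, latticeLength_eq_one haz] at hlen
    rw [hba, latticeLength_smul, latticeLength_eq_one haz]
    omega

/-- An edge of the truncation inside the cutting hyperplane is parallel to an edge of the facet
and has length at least `k - 1`. -/
lemma IsEdge.le_latticeLength_of_eq_one (hP : IsSmoothPolytope P) (hk : 2 ≤ k)
    (hE : EdgesAtLeast P k) (hpos : CanonicallyPositioned P) (hF : IsFacet P (P ∩ {x | x i = 0}))
    (h : IsEdge (P ∩ {x | 1 ≤ x i}) a b) (ha : a i = 1) (hb : b i = 1) :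
    k - 1 ≤ latticeLength (b - a) := by
  have hk1 : 1 ≤ k := by omega
  have hkR : (2 : ℝ) ≤ k := by exact_mod_cast hk
  have hconv := hP.1.convex
  have hnn : ∀ x ∈ P, 0 ≤ x i := fun x hx => hpos.apply_nonneg hF hx
  have hai : toR a i = 1 := by simp [toR, ha]
  have hbi : toR b i = 1 := by simp [toR, hb]
  obtain ⟨l, haP, hbP, hlb, hle, heq⟩ := h.exists_dual
  obtain ⟨v, C, j, hvi, hj, hav⟩ :=
    (mem_extremePoints_slice_of_eq_one hP hk1 hE hpos hF h.isVertex_left hai).resolve_left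
      fun h1 => apply_ne_one_of_isVertex hP hk hE hpos hF h1 hai
  have hdi : ∀ r, toR (C.dir r) i = if r = j then 1 else 0 := fun r => by
    rw [← hj (toR _), C.coord_dir]
    simp only [eq_comm]
  have hvi' : toR v i = 0 := by simp [toR, hvi]
  have hba : ∀ r, 0 ≤ C.coord r (toR b - toR a) := fun r => by
    by_cases hr : r = j
    · rw [hr, hj, Pi.sub_apply, hai, hbi, sub_self]
    · have h1 := C.coord_nonneg r _ hbP.1
      rw [hav, ← sub_sub, map_sub, C.coord_dir, if_neg hr, sub_zero]
      exact h1
  have hstep : ∀ r, r ≠ j → toR a + (1 / 2 : ℝ) • toR (C.dir r) ∈ P ∩ {x | 1 ≤ x i} := by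
    intro r hr
    refine ⟨?_, ?_⟩
    · have h1 := C.add_smul_dir_mem_of_le hconv j (t := 2) (by norm_num) hkR
      have h2 := C.add_smul_dir_mem_of_le hconv r (t := 1) (by norm_num) (by linarith)
      have h3 := hconv h1 h2 (a := 1 / 2) (b := 1 / 2) (by norm_num) (by norm_num) (by norm_num)
      rw [hav]
      convert h3 using 1
      module
    · simp [hai, hdi, hr]
  have hlr : ∀ r, r ≠ j → l (toR (C.dir r)) ≤ 0 := fun r hr => by
    have h1 := hle _ (hstep r hr)
    rw [map_add, map_smul, smul_eq_mul] at h1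
    linarith
  have hbaj : C.coord j (toR b - toR a) = 0 := by rw [hj, Pi.sub_apply, hai, hbi, sub_self]
  obtain ⟨e, he⟩ : ∃ e, C.coord e (toR b - toR a) ≠ 0 := by
    by_contra! hcon
    have h1 := C.sum_coord (toR b - toR a)
    simp only [hcon, zero_smul, Finset.sum_const_zero] at h1
    exact h.1 (toR_injective (sub_eq_zero.1 h1.symm).symm)
  have hej : e ≠ j := fun h1 => he (h1 ▸ hbaj)
  have hle0 : l (toR (C.dir e)) = 0 := by
    have h1 : ∑ r, C.coord r (toR b - toR a) * l (toR (C.dir r)) = 0 := by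
      have := congrArg l (C.sum_coord (toR b - toR a))
      simpa [hlb] using this
    have h2 := (Finset.sum_eq_zero_iff_of_nonpos fun r _ => by
      by_cases hr : r = j
      · rw [hr, hbaj, zero_mul]
      · exact mul_nonpos_of_nonneg_of_nonpos (hba r) (hlr r hr)).1 h1 e (Finset.mem_univ e)
    exact (mul_eq_zero.1 h2).resolve_left he
  obtain ⟨t, ht0, hte⟩ : ∃ t : ℝ, t ≠ 0 ∧ toR (C.dir e) = t • (toR b - toR a) := by
    have h1 := heq _ (hstep e hej) (by rw [map_add, map_smul, hle0, smul_zero, add_zero])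
    rw [segment_eq_image'] at h1
    obtain ⟨t, -, h1⟩ := h1
    have h2 : t • (toR b - toR a) = (1 / 2 : ℝ) • toR (C.dir e) := add_left_cancel h1
    have h3 : toR (C.dir e) = (2 * t) • (toR b - toR a) := by
      rw [mul_smul, h2, smul_smul]; norm_num
    refine ⟨2 * t, fun h4 => ?_, h3⟩
    have h5 := C.coord_dir e e
    rw [h3, h4, zero_smul, map_zero, if_pos rfl] at h5
    exact zero_ne_one h5
  obtain ⟨c, hc⟩ := C.coord_int e (b - a)
  have hbac : toR b - toR a = (c : ℝ) • toR (C.dir e) := by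
    have h1 := C.coord_dir e e
    rw [hte, map_smul, if_pos rfl, smul_eq_mul, ← toR_sub, hc] at h1
    rw [hte, smul_smul, mul_comm, h1, one_smul]
  -- the other end of the edge of `P` at `v` in direction `C.dir e`
  set w : Fin n → ℤ := v + C.len e • C.dir e with hw
  have hwv : toR w = toR v + (C.len e : ℝ) • toR (C.dir e) := by rw [hw, toR_add, toR_nsmul]
  have hwi : w i = 0 := by
    have h1 := congrFun hwv i
    simp only [Pi.add_apply, Pi.smul_apply, hvi', hdi, if_neg hej, smul_zero, add_zero] at h1
    simpa [toR] using h1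
  have hwi' : toR w i = 0 := by simp [toR, hwi]
  obtain ⟨D⟩ := nonempty_smoothChart hP hE (C.isEdge e).symm.isVertex_left
  obtain ⟨m, hm⟩ := D.exists_coord_eq hk1 hconv hnn hF hwi
  have hDi : toR (D.dir m) i = 1 := by rw [← hm (toR _), D.coord_dir, if_pos rfl]
  have hcoordw : ∀ r, r ≠ e → ∀ x, C.coord r (x - toR v) = C.coord r (x - toR w) := by
    intro r hr x
    rw [hwv, ← sub_sub, map_sub _ (x - toR v), map_smul, C.coord_dir, if_neg hr, smul_zero,
      sub_zero]
  have hDmem : ∀ r, toR w + toR (D.dir r) ∈ P := fun r => by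
    have := D.add_smul_dir_mem_of_le hconv r zero_le_one (by linarith)
    rwa [one_smul] at this
  have hzero : ∀ r, r ≠ e → r ≠ j → C.coord r (toR (D.dir m)) = 0 := by
    intro r hre hrj
    have h1 : C.coord r (toR a - toR w) = 0 := by
      rw [← hcoordw r hre, hav, add_sub_cancel_left, C.coord_dir, if_neg hrj]
    have h2 : ∑ q, D.coord q (toR a - toR w) * C.coord r (toR (D.dir q)) = 0 := by
      have := congrArg (C.coord r) (D.sum_coord (toR a - toR w))
      simpa [h1] using this
    have h3 := (Finset.sum_eq_zero_iff_of_nonneg fun q _ => by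
      refine mul_nonneg (D.coord_nonneg q _ haP.1) ?_
      have := C.coord_nonneg r _ (hDmem q)
      rwa [hcoordw r hre, add_sub_cancel_left] at this).1 h2 m (Finset.mem_univ m)
    rw [hm, Pi.sub_apply, hai, hwi', sub_zero, one_mul] at h3
    exact h3
  obtain ⟨d, hd⟩ := C.coord_int e (D.dir m)
  have hDm : toR (D.dir m) = toR (C.dir j) + (d : ℝ) • toR (C.dir e) := by
    have h1 := C.sum_coord (toR (D.dir m))
    rw [← Finset.sum_subset (Finset.subset_univ {e, j}) fun r _ hr => by
      simp only [Finset.mem_insert, Finset.mem_singleton, not_or] at hr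
      rw [hzero r hr.1 hr.2, zero_smul], Finset.sum_pair hej, hd, hj, hDi, one_smul] at h1
    rw [← h1, add_comm]
  have h1 : ((C.len e : ℤ) + d : ℤ) ≤ c := by
    have hmem : toR w + toR (D.dir m) ∈ P ∩ {x | 1 ≤ x i} :=
      ⟨hDmem m, by simp [hwi', hDi]⟩
    have hwa : toR w + toR (D.dir m) = toR a + ((C.len e : ℝ) + d) • toR (C.dir e) := by
      rw [hwv, hDm, hav]; module
    have hseg := heq _ hmem (by rw [hwa, map_add, map_smul, hle0, smul_zero, add_zero])
    rw [segment_eq_image', hwa] at hseg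
    obtain ⟨s, hs, hseg⟩ := hseg
    have h2 := congrArg (C.coord e) (add_left_cancel hseg)
    rw [map_smul, map_smul, C.coord_dir, if_pos rfl, ← toR_sub, hc, smul_eq_mul, smul_eq_mul,
      mul_one] at h2
    have hc0 : (0 : ℝ) ≤ c := by
      have := hba e
      rwa [← toR_sub, hc] at this
    have h3 : ((C.len e : ℝ) + d) ≤ c := by
      rw [← h2]
      exact mul_le_of_le_one_left hc0 hs.2
    exact_mod_cast h3
  have h2 : (0 : ℤ) ≤ C.len e + k * d := by
    have h3 := C.coord_nonneg e _ (D.add_smul_dir_mem_of_le hconv m (Nat.cast_nonneg k) le_rfl)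
    have h4 : toR w + (k : ℝ) • toR (D.dir m) - toR v =
        ((C.len e : ℝ) + k * d) • toR (C.dir e) + (k : ℝ) • toR (C.dir j) := by
      rw [hwv, hDm]; module
    rw [h4, map_add, map_smul, map_smul, C.coord_dir, C.coord_dir, if_pos rfl, if_neg hej,
      smul_zero, add_zero, smul_eq_mul, mul_one] at h3
    exact_mod_cast h3
  have h3 : (k : ℤ) ≤ C.len e := by exact_mod_cast C.le_len e
  have h4 : (k : ℤ) - 1 ≤ c := by
    have hk' : (2 : ℤ) ≤ k := by exact_mod_cast hk
    rcases le_or_gt 0 d with hd0 | hd0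
    · linarith
    · nlinarith
  have hbac' : b - a = c • C.dir e := by
    apply toR_injective
    rw [toR_sub, toR_smul, hbac]
  have hpos : 0 < latticeLength (C.dir e) := by
    refine Nat.pos_of_ne_zero (latticeLength_ne_zero fun h5 => ?_)
    rw [h5, smul_zero, sub_eq_zero] at hbac'
    exact h.1 hbac'.symm
  rw [hbac', latticeLength_smul]
  calc k - 1 ≤ c.natAbs := by omega
    _ ≤ c.natAbs * latticeLength (C.dir e) := Nat.le_mul_of_pos_right _ hpos

lemma edgesAtLeast_slice (hP : IsSmoothPolytope P) (hE : EdgesAtLeast P k)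
    (hpos : CanonicallyPositioned P) (hF : IsFacet P (P ∩ {x | x i = 0})) :
    EdgesAtLeast (P ∩ {x | 1 ≤ x i}) (k - 1) := by
  intro a b h
  have hnn : ∀ x ∈ P, 0 ≤ x i := fun x hx => hpos.apply_nonneg hF hx
  have one_le : ∀ z : Fin n → ℤ, toR z ∈ P ∩ {x | 1 ≤ x i} → 1 ≤ z i := fun z hz => by
    have h1 : 1 ≤ toR z i := hz.2
    simp only [toR] at h1
    exact_mod_cast h1
  rcases (one_le a (extremePoints_subset h.isVertex_left)).eq_or_lt with ha | ha
  · rcases (one_le b (extremePoints_subset h.symm.isVertex_left)).eq_or_lt with hb | hb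
    · rcases le_or_gt k 1 with hk | hk
      · omega
      · exact h.le_latticeLength_of_eq_one hP hk hE hpos hF ha.symm hb.symm
    · exact h.le_latticeLength_of_one_lt hP.1 hE hnn hb
  · rw [latticeLength_sub_comm]
    exact h.symm.le_latticeLength_of_one_lt hP.1 hE hnn ha

end SliceEdge

/-- (Claim 3.6 of the paper.) Let `P ⊂ ℝⁿ` be a full-dimensional smooth
lattice polytope, canonically positioned, with `F = P ∩ {x₁ = 0}` a facet, and with
every edge of lattice length at least `k ≥ 1`. Then `P' = P ∩ {x₁ ≥ 1}` is a lattice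
polytope and every edge of `P'` has lattice length at least `k - 1`. -/
theorem stmt_9 {n k : ℕ} (hn : 0 < n) (hk : 1 ≤ k) (P : Set (Fin n → ℝ))
    (hP : IsSmoothPolytope P) (hpos : CanonicallyPositioned P)
    (hF : IsFacet P (P ∩ {x | x ⟨0, hn⟩ = 0}))
    (hEdge : EdgesAtLeast P k) :
    IsLatticePolytope (P ∩ {x | 1 ≤ x ⟨0, hn⟩}) ∧
    EdgesAtLeast (P ∩ {x | 1 ≤ x ⟨0, hn⟩}) (k - 1) := by
  exact ⟨isLatticePolytope_slice hP hk hEdge hpos hF, edgesAtLeast_slice hP hEdge hpos hF⟩
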